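/- arXiv:2001.00477 — 2 statements merged into one kernel-verified Lean document; each statement's English description precedes it below -/
import Mathlib

section
/- If a finite simple connected graph G contains no induced cycle of length at least t (for t ≥ 4), then the cop number of G is at most t − 3 (with the convention that at least one cop is used, i.e., c(G) ≤ max(1, t−3)). -/
open SimpleGraph

variable {V : Type*}

/-- The closed neighborhood `N[v]` of a vertex. -/
def closedNbhd (G : SimpleGraph V) (v : V) : Set V := insert v (G.neighborSet v)

/-- A legal move in the game: stay put or move along an edge. -/
def Step (G : SimpleGraph V) (u w : V) : Prop := u = w ∨ G.Adj u w

/-- A strategy for `k` cops: initial placement, and a move function (cops see all positions),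
each cop staying or moving along an edge. -/
structure CopStrategy (G : SimpleGraph V) (k : ℕ) where
  init : Fin k → V
  move : (Fin k → V) → V → (Fin k → V)
  move_valid : ∀ c r i, Step G (c i) (move c r i)

/-- A strategy for the robber: initial placement after seeing the cops, and a move
function (after seeing the cops' new positions), staying or moving along an edge. -/
structure RobberStrategy (G : SimpleGraph V) (k : ℕ) where
  init : (Fin k → V) → V
  move : (Fin k → V) → V → V
  move_valid : ∀ c r, Step G r (move c r)

/-- The state of the play after `n` full rounds: cops' positions and robber's position.
In each round the cops move first, then the robber moves. -/
def play {G : SimpleGraph V} {k : ℕ} (S : CopStrategy G k) (R : RobberStrategy G k) :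
    ℕ → (Fin k → V) × V
  | 0 => (S.init, R.init S.init)
  | n + 1 =>
    let p := play S R n
    let c' := S.move p.1 p.2
    (c', R.move c' p.2)

/-- The cops win with strategy `S` if against every robber strategy, at some cop move a cop
lands on the robber's current vertex. -/
def CopsWin {G : SimpleGraph V} {k : ℕ} (S : CopStrategy G k) : Prop :=
  ∀ R : RobberStrategy G k, ∃ n i,
    S.move (play S R n).1 (play S R n).2 i = (play S R n).2

/-- The cops capture the robber within `m` cop moves. -/
def CapturesWithin {G : SimpleGraph V} {k : ℕ} (S : CopStrategy G k) (m : ℕ) : Prop :=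
  ∀ R : RobberStrategy G k, ∃ n, n + 1 ≤ m ∧
    ∃ i, S.move (play S R n).1 (play S R n).2 i = (play S R n).2

/-- The cop number of `G`: the least `k` such that `k` cops have a winning strategy. -/
noncomputable def copNumber (G : SimpleGraph V) : ℕ :=
  sInf {k | ∃ S : CopStrategy G k, CopsWin S}

/-- A set `U` is Dilworth if for all distinct `u v ∈ U`, `N(u) \ N[v] ≠ ∅` and
`N(v) \ N[u] ≠ ∅`. -/
def IsDilworthSet (G : SimpleGraph V) (U : Finset V) : Prop :=
  ∀ u ∈ U, ∀ v ∈ U, u ≠ v →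
    (G.neighborSet u \ closedNbhd G v).Nonempty ∧ (G.neighborSet v \ closedNbhd G u).Nonempty

/-- The Dilworth number of `G`: the largest size of a Dilworth set. -/
noncomputable def dilworthNumber (G : SimpleGraph V) : ℕ :=
  sSup {n | ∃ U : Finset V, IsDilworthSet G U ∧ U.card = n}

/-- `zval G v`: the maximum number of vertices of an induced path of `G` with endpoint `v`. -/
noncomputable def zval (G : SimpleGraph V) (v : V) : ℕ :=
  sSup {n | ∃ f : pathGraph n ↪g G, ∃ h : 0 < n, f ⟨0, h⟩ = v}

/-- `zNum G = min over v of zval G v`. -/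
noncomputable def zNum (G : SimpleGraph V) : ℕ :=
  sInf {n | ∃ v : V, zval G v = n}

namespace CopHole

/-- `Win n c r`: cops to move at `(c, r)` can capture within `n` moves. -/
def Win (G : SimpleGraph V) (k : ℕ) : ℕ → (Fin k → V) → V → Prop
  | 0, _, _ => False
  | n + 1, c, r => ∃ c' : Fin k → V, (∀ i, Step G (c i) (c' i)) ∧
      ((∃ i, c' i = r) ∨ ∀ r', Step G r r' → Win G k n c' r')

open Classical in
theorem exists_strategy (G : SimpleGraph V) (k : ℕ) (c0 : Fin k → V)
    (h : ∀ r, ∃ n, Win G k n c0 r) : ∃ S : CopStrategy G k, CopsWin S := by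
  have key : ∀ c : Fin k → V, ∀ r : V, ∃ c' : Fin k → V, (∀ i, Step G (c i) (c' i)) ∧
      ∀ hn : (∃ n, Win G k n c r), ∃ n, n < Nat.find hn ∧
        ((∃ i, c' i = r) ∨ ∀ r', Step G r r' → Win G k n c' r') := by
    intro c r
    by_cases hn : ∃ n, Win G k n c r
    · have hs := Nat.find_spec hn
      rcases hm : Nat.find hn with _ | n
      · rw [hm] at hs
        exact hs.elim
      · rw [hm] at hs
        obtain ⟨c', h1, h2⟩ := hs
        exact ⟨c', h1, fun _ => ⟨n, by omega, h2⟩⟩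
    · exact ⟨c, fun i => Or.inl rfl, fun h => (hn h).elim⟩
  choose mv hv hw using key
  refine ⟨⟨c0, mv, hv⟩, ?_⟩
  intro R
  set S : CopStrategy G k := ⟨c0, mv, hv⟩ with hS
  have main : ∀ n N, Win G k n (play S R N).1 (play S R N).2 → ∃ n i,
    S.move (play S R n).1 (play S R n).2 i = (play S R n).2 := by
    intro n
    induction n using Nat.strong_induction_on with
    | _ n ih =>
      intro N hN
      have hex : ∃ n, Win G k n (play S R N).1 (play S R N).2 := ⟨n, hN⟩
      obtain ⟨n', hlt, h2⟩ := hw _ _ hex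
      have hle := Nat.find_min' hex hN
      rcases h2 with ⟨i, hi⟩ | h2
      · exact ⟨N, i, hi⟩
      · exact ih n' (by omega) (N + 1) (h2 _ (R.move_valid _ _))
  obtain ⟨n, hn⟩ := h (R.init c0)
  exact main n 0 hn

theorem Win.mono_one {G : SimpleGraph V} {k : ℕ} {c : Fin k → V} {r : V} {i : Fin k}
    (h : Step G (c i) r) (n : ℕ) : Win G k (n + 1) c r := by
  classical
  refine ⟨Function.update c i r, fun j => ?_, Or.inl ⟨i, by simp⟩⟩
  by_cases hj : j = i
  · subst hj; simpa using h
  · simp [hj, Step]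

/-- adjacency inside a set -/
def RelIn (G : SimpleGraph V) (C : Set V) (x y : V) : Prop := G.Adj x y ∧ x ∈ C ∧ y ∈ C

def Conn (G : SimpleGraph V) (C : Set V) : Prop :=
  ∀ x ∈ C, ∀ y ∈ C, Relation.ReflTransGen (RelIn G C) x y

theorem rtgMono {α : Type*} {R R' : α → α → Prop} (hR : ∀ x y, R x y → R' x y) {x y : α}
    (h : Relation.ReflTransGen R x y) : Relation.ReflTransGen R' x y := by
  induction h with
  | refl => exact Relation.ReflTransGen.refl
  | tail _ h2 ih => exact ih.tail (hR _ _ h2)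

theorem exit {α : Type*} {R : α → α → Prop} {P : α → Prop} {x y : α}
    (h : Relation.ReflTransGen R x y) (hx : P x) (hy : ¬ P y) :
    ∃ u w, R u w ∧ P u ∧ ¬ P w := by
  induction h with
  | refl => exact (hy hx).elim
  | @tail b c hab hbc ih =>
    by_cases hb : P b
    · exact ⟨b, c, hbc, hb, hy⟩
    · exact ih hb

theorem comp_lemma {G : SimpleGraph V} {C : Set V} (hC : Conn G C) {b r y0 : V}
    (hr : r ∈ C) (hrb : ¬ Step G b r) (hy0 : y0 ∈ C) (hby : Step G b y0) :
    ∃ C' : Set V, C' ⊆ C ∧ (∀ x ∈ C', ¬ Step G b x) ∧ r ∈ C' ∧ Conn G C' ∧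
      (∀ x ∈ C', ∀ y ∈ C, G.Adj x y → y ∈ C' ∨ Step G b y) ∧
      ∃ b' ∈ C, G.Adj b b' ∧ ∃ y ∈ C', G.Adj b' y := by
  set S : Set V := {x | x ∈ C ∧ ¬ Step G b x} with hS
  set C' : Set V := {y | Relation.ReflTransGen (RelIn G S) r y} with hC'
  have hrC' : r ∈ C' := Relation.ReflTransGen.refl
  have hsub : ∀ x ∈ C', x ∈ S := by
    intro x hx
    rcases Relation.ReflTransGen.cases_tail hx with h | ⟨z, _, h⟩
    · subst h; exact ⟨hr, hrb⟩
    · exact h.2.2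
  have hcl : ∀ x ∈ C', ∀ y ∈ S, G.Adj x y → y ∈ C' := by
    intro x hx y hy hxy
    exact Relation.ReflTransGen.tail hx ⟨hxy, hsub x hx, hy⟩
  have hcl' : ∀ x ∈ C', ∀ y ∈ C, G.Adj x y → y ∈ C' ∨ Step G b y := by
    intro x hx y hy hxy
    by_cases h : Step G b y
    · exact Or.inr h
    · exact Or.inl (hcl x hx y ⟨hy, h⟩ hxy)
  have hto : ∀ y, y ∈ C' → Relation.ReflTransGen (RelIn G C') r y := by
    intro y hy
    have hy' : Relation.ReflTransGen (RelIn G S) r y := hy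
    clear hy
    induction hy' with
    | refl => exact Relation.ReflTransGen.refl
    | @tail u w h1 h2 ih => exact ih.tail ⟨h2.1, h1, Relation.ReflTransGen.tail h1 h2⟩
  have hsymm : ∀ {x y}, RelIn G C' x y → RelIn G C' y x := fun h => ⟨h.1.symm, h.2.2, h.2.1⟩
  have hback : ∀ y, y ∈ C' → Relation.ReflTransGen (RelIn G C') y r := by
    intro y hy
    have := hto y hy
    clear hy
    induction this with
    | refl => exact Relation.ReflTransGen.refl
    | tail h1 h2 ih => exact Relation.ReflTransGen.head (hsymm h2) ih
  refine ⟨C', fun x hx => (hsub x hx).1, fun x hx => (hsub x hx).2, hrC', ?_, hcl', ?_⟩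
  · intro x hx y hy
    exact (hback x hx).trans (hto y hy)
  · have hy0' : ¬ (y0 ∈ C') := fun h => (hsub _ h).2 hby
    obtain ⟨u, w, huw, hu, hw⟩ := exit (P := fun x => x ∈ C') (hC r hr y0 hy0) hrC' hy0'
    have hbw := (hcl' u hu w huw.2.2 huw.1).resolve_left hw
    refine ⟨w, huw.2.2, ?_, u, hu, huw.1.symm⟩
    rcases hbw with h | h
    · subst h
      exact ((hsub u hu).2 (Or.inr huw.1.symm)).elim
    · exact h

theorem seq_of_rtg {α : Type*} {R : α → α → Prop} {x y : α} (h : Relation.ReflTransGen R x y) :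
    ∃ (l : ℕ) (f : ℕ → α), f 0 = x ∧ f l = y ∧ ∀ i < l, R (f i) (f (i + 1)) := by
  induction h with
  | refl => exact ⟨0, fun _ => x, rfl, rfl, by simp⟩
  | @tail u w _ h2 ih =>
    obtain ⟨l, f, h0, hl, hs⟩ := ih
    refine ⟨l + 1, fun i => if i ≤ l then f i else w, by simp [h0], by simp, ?_⟩
    intro i hi
    rcases Nat.lt_or_ge i l with h | h
    · have h1 : i + 1 ≤ l := h
      simpa [h.le, h1] using hs i h
    · have : i = l := by omega
      subst this
      simpa [hl] using h2

/-- minimal path -/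
theorem min_seq {G : SimpleGraph V} {D : Set V} {x y : V}
    (h : Relation.ReflTransGen (RelIn G D) x y) :
    ∃ (l : ℕ) (f : ℕ → V), f 0 = x ∧ f l = y ∧ (∀ i < l, RelIn G D (f i) (f (i + 1))) ∧
      ∀ i j, i < j → j ≤ l → f i ≠ f j ∧ (G.Adj (f i) (f j) ↔ j = i + 1) := by
  classical
  have hex := seq_of_rtg h
  obtain ⟨f, h0, hl, hs⟩ := Nat.find_spec hex
  have hmin : ∀ l', l' < Nat.find hex → ¬ _ := fun l' h => Nat.find_min hex h
  set l := Nat.find hex with hldef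
  refine ⟨l, f, h0, hl, hs, ?_⟩
  intro i j hij hjl
  refine ⟨fun heq => ?_, fun hadj => ?_, fun hj => hj ▸ (hs i (by omega)).1⟩
  · apply hmin (l - (j - i)) (by omega)
    refine ⟨fun z => if z ≤ i then f z else f (z + (j - i)), by simp [h0], ?_, ?_⟩
    · by_cases hz : l - (j - i) ≤ i
      · have h1 : l - (j - i) = i := by omega
        have h2 : j = l := by omega
        simp only [h1, le_refl, if_true]
        rw [heq, h2, hl]
      · simp only [hz, if_false]
        rw [← hl]; congr 1; omega
    · intro z hz
      rcases lt_trichotomy z i with h | h | h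
      · have h1 : z + 1 ≤ i := h
        simpa [h.le, h1] using hs z (by omega)
      · subst h
        have := hs j (by omega)
        simp only [le_refl, if_true, Nat.not_succ_le_self, if_false]
        rw [heq]
        convert this using 2
        omega
      · have h1 : ¬ z ≤ i := by omega
        have h2 : ¬ z + 1 ≤ i := by omega
        simp only [h1, h2, if_false]
        convert hs (z + (j - i)) (by omega) using 2
        omega
  · by_contra hne
    apply hmin (l - (j - i - 1)) (by omega)
    have hiD : f i ∈ D := (hs i (by omega)).2.1
    have hjD : f j ∈ D := by
      have := (hs (j - 1) (by omega)).2.2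
      rwa [show j - 1 + 1 = j by omega] at this
    refine ⟨fun z => if z ≤ i then f z else f (z + (j - i - 1)), by simp [h0], ?_, ?_⟩
    · have hz : ¬ l - (j - i - 1) ≤ i := by omega
      simp only [hz, if_false]
      rw [← hl]; congr 1; omega
    · intro z hz
      rcases lt_trichotomy z i with h | h | h
      · have h1 : z + 1 ≤ i := h
        simpa [h.le, h1] using hs z (by omega)
      · subst h
        simp only [le_refl, if_true, Nat.not_succ_le_self, if_false]
        rw [show z + 1 + (j - z - 1) = j by omega]
        exact ⟨hadj, hiD, hjD⟩
      · have h1 : ¬ z ≤ i := by omega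
        have h2 : ¬ z + 1 ≤ i := by omega
        simp only [h1, h2, if_false]
        convert hs (z + (j - i - 1)) (by omega) using 2
        omega

theorem cycle_embed {G : SimpleGraph V} {n : ℕ} (hn : 3 ≤ n) (w : ℕ → V)
    (hw : ∀ i j, i < j → j < n →
      w i ≠ w j ∧ (G.Adj (w i) (w j) ↔ (j = i + 1 ∨ (i = 0 ∧ j + 1 = n)))) :
    Nonempty (cycleGraph n ↪g G) := by
  have hcyc : ∀ u v : Fin n, u < v → ((cycleGraph n).Adj u v ↔
      (v.val = u.val + 1 ∨ (u.val = 0 ∧ v.val + 1 = n))) := by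
    intro u v huv
    have h1 : u.val < v.val := huv
    have := u.2
    have := v.2
    rw [cycleGraph_adj', Fin.sub_val_of_le huv.le, Fin.coe_sub_iff_lt.mpr huv]
    omega
  refine ⟨⟨⟨fun i => w i, ?_⟩, ?_⟩⟩
  · intro a b hab
    by_contra hne
    rcases lt_or_gt_of_ne hne with h | h
    · exact (hw a b h b.2).1 hab
    · exact (hw b a h a.2).1 hab.symm
  · intro a b
    change G.Adj (w a) (w b) ↔ _
    rcases lt_trichotomy a b with h | h | h
    · rw [hcyc a b h, (hw a b h b.2).2]
    · subst h; simp
    · rw [G.adj_comm, (cycleGraph n).adj_comm, hcyc b a h, (hw b a h a.2).2]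

structure Inv (G : SimpleGraph V) (m : ℕ) (v : ℕ → V) (τ : ℕ) (C : Set V) (b : V) : Prop where
  h1 : ∀ p, p ≤ τ → τ < p + m → ∀ x ∈ C, ¬ Step G (v p) x
  h2 : ∀ y ∈ C, ∀ x, x ∉ C → G.Adj y x → ∃ p, p ≤ τ ∧ τ < p + m ∧ Step G (v p) x
  h3 : Conn G C
  h4a : G.Adj (v τ) b
  h4b : ∃ y ∈ C, G.Adj b y
  h4c : ∀ p, p < τ → τ < p + m → ¬ G.Adj (v p) b
  h5 : ∀ p q, p < q → q ≤ τ → τ < p + m → v p ≠ v q ∧ (G.Adj (v p) (v q) ↔ q = p + 1)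

theorem Inv.hole {G : SimpleGraph V} {m : ℕ} (hm : 1 ≤ m) {v : ℕ → V} {τ : ℕ} {C : Set V} {b : V}
    (H : Inv G m v τ C b) {a y : V} (hy : y ∈ C) (ha : a ∉ C) (hya : G.Adj y a)
    {p : ℕ} (hp : p + m = τ + 1) (hpa : Step G (v p) a)
    (hna : ∀ q, p < q → q ≤ τ → ¬ Step G (v q) a) (hba : ¬ Step G b a) :
    ∃ n, m + 3 ≤ n ∧ Nonempty (cycleGraph n ↪g G) := by
  have hpa' : G.Adj (v p) a := by
    rcases hpa with h | h
    · subst h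
      exact (H.h1 p (by omega) (by omega) y hy (Or.inr hya.symm)).elim
    · exact h
  obtain ⟨z, hz, hbz⟩ := H.h4b
  set D : Set V := {x | x ∈ C ∨ x = a ∨ x = b} with hD
  have hpath : Relation.ReflTransGen (RelIn G D) b a := by
    have hzy : Relation.ReflTransGen (RelIn G D) z y :=
      CopHole.rtgMono (fun x y h => ⟨h.1, Or.inl h.2.1, Or.inl h.2.2⟩) (H.h3 z hz y hy)
    exact (Relation.ReflTransGen.head ⟨hbz, Or.inr (Or.inr rfl), Or.inl hz⟩ hzy).tail
      ⟨hya, Or.inl hy, Or.inr (Or.inl rfl)⟩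
  obtain ⟨l, f, h0, hl, hs, hind⟩ := min_seq hpath
  have hl2 : 2 ≤ l := by
    by_contra hlt
    have : l = 0 ∨ l = 1 := by omega
    rcases this with h | h
    · subst h; exact hba (Or.inl (h0.symm.trans hl))
    · subst h
      have := (hs 0 (by omega)).1
      rw [h0, hl] at this
      exact hba (Or.inr this)
  have hfC : ∀ i, 0 < i → i < l → f i ∈ C := by
    intro i hi hil
    rcases (hs i hil).2.1 with h | h | h
    · exact h
    · exact ((hind i l hil le_rfl).1 (h.trans hl.symm)).elim
    · exact ((hind 0 i hi hil.le).1 (h0.trans h.symm)).elim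
  refine ⟨m + l + 1, by omega, cycle_embed (by omega)
    (fun i => if i < m then v (p + i) else f (i - m)) ?_⟩
  intro i j hij hj
  by_cases hjm : j < m
  · have him : i < m := by omega
    simp only [hjm, him, if_true]
    obtain ⟨h1, h2⟩ := H.h5 (p + i) (p + j) (by omega) (by omega) (by omega)
    refine ⟨h1, h2.trans ?_⟩
    omega
  · by_cases him : i < m
    · simp only [hjm, him, if_true, if_false]
      rcases Nat.eq_zero_or_pos (j - m) with hjz | hjpos
      · rw [hjz, h0]
        refine ⟨fun h => ?_, ?_⟩
        · exact H.h1 (p + i) (by omega) (by omega) z hz (Or.inr (h ▸ hbz))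
        · by_cases hi : p + i = τ
          · rw [hi]
            exact ⟨fun _ => by omega, fun _ => H.h4a⟩
          · exact ⟨fun h => (H.h4c (p + i) (by omega) (by omega) h).elim, fun h => by omega⟩
      · by_cases hjl : j - m = l
        · rw [hjl, hl]
          rcases Nat.eq_zero_or_pos i with hi | hi
          · subst hi
            exact ⟨hpa'.ne, fun _ => by omega, fun _ => hpa'⟩
          · have := hna (p + i) (by omega) (by omega)
            exact ⟨fun h => this (Or.inl h), fun h => (this (Or.inr h)).elim, fun h => by omega⟩
        · have := H.h1 (p + i) (by omega) (by omega) _ (hfC (j - m) hjpos (by omega))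
          exact ⟨fun h => this (Or.inl h), fun h => (this (Or.inr h)).elim, fun h => by omega⟩
    · simp only [hjm, him, if_false]
      obtain ⟨h1, h2⟩ := hind (i - m) (j - m) (by omega) (by omega)
      refine ⟨h1, h2.trans ?_⟩
      omega

theorem Inv.win [Fintype V] {G : SimpleGraph V} {m : ℕ} (hm : 1 ≤ m)
    (hhole : ∀ n, m + 3 ≤ n → IsEmpty (cycleGraph n ↪g G)) :
    ∀ (N : ℕ) (v : ℕ → V) (τ : ℕ) (C : Set V) (b : V), Inv G m v τ C b → C.ncard ≤ N →
      ∀ r ∈ C, Win G m (N + 1) (fun i : Fin m => v (τ + i + 1 - m)) r := by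
  classical
  intro N
  induction N with
  | zero =>
    intro v τ C b H hN r hr
    have : C.ncard = 0 := by omega
    rw [Set.ncard_eq_zero] at this
    simp [this] at hr
  | succ N ih =>
    intro v τ C b H hN r hr
    set v' : ℕ → V := Function.update v (τ + 1) b with hv'
    have hvo : ∀ p, p ≤ τ → v' p = v p := fun p hp => by
      rw [hv', Function.update_of_ne (by omega)]
    have hvn : v' (τ + 1) = b := by simp [hv']
    have guard : ∀ y ∈ C, ∀ x, x ∉ C → G.Adj y x →
        ∃ p, p ≤ τ + 1 ∧ τ + 1 < p + m ∧ Step G (v' p) x := by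
      intro y hy x hx hyx
      obtain ⟨p, hp1, hp2, hp3⟩ := H.h2 y hy x hx hyx
      by_cases hp : τ + 1 < p + m
      · exact ⟨p, by omega, hp, by rwa [hvo p hp1]⟩
      · by_contra hcon
        push Not at hcon
        obtain ⟨n, hn, ⟨e⟩⟩ := H.hole hm hy hx hyx (p := p) (by omega) hp3
          (fun q hq1 hq2 => by
            have := hcon q (by omega) (by omega)
            rwa [hvo q hq2] at this)
          (by
            have := hcon (τ + 1) (by omega) (by omega)
            rwa [hvn] at this)
        exact (hhole n hn).false e
    have hwin1 : ∀ q x, q ≤ τ + 1 → τ + 1 < q + m → Step G (v' q) x →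
        Win G m (N + 1) (fun i : Fin m => v' (τ + 1 + i + 1 - m)) x := by
      intro q x hq1 hq2 hq
      refine Win.mono_one (i := ⟨q + m - (τ + 2), by omega⟩) ?_ N
      have : τ + 1 + (q + m - (τ + 2)) + 1 - m = q := by omega
      simpa only [this] using hq
    refine ⟨fun i : Fin m => v' (τ + 1 + i + 1 - m), ?_, Or.inr ?_⟩
    · intro i
      have hi := i.2
      by_cases h : τ + i + 1 < m
      · left
        have e1 : τ + i + 1 - m = 0 := by omega
        have e2 : τ + 1 + i + 1 - m = 0 := by omega
        simp only [e1, e2]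
        rw [hvo 0 (by omega)]
      · right
        have e2 : τ + 1 + i + 1 - m = (τ + i + 1 - m) + 1 := by omega
        simp only [e2]
        by_cases hl : τ + i + 1 - m = τ
        · rw [hl, hvn]; exact H.h4a
        · rw [hvo _ (by omega)]
          exact (H.h5 _ _ (by omega) (by omega) (by omega)).2.2 rfl
    · intro r' hrr'
      by_cases hcap : ∃ q, q ≤ τ + 1 ∧ τ + 1 < q + m ∧ Step G (v' q) r'
      · obtain ⟨q, hq1, hq2, hq⟩ := hcap
        exact hwin1 q r' hq1 hq2 hq
      · have hr'C : r' ∈ C := by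
          by_contra hr'
          rcases hrr' with h | h
          · exact hr' (h ▸ hr)
          · exact hcap (guard r hr r' hr' h)
        have hr'b : ¬ Step G b r' := fun h => hcap ⟨τ + 1, le_rfl, by omega, by rwa [hvn]⟩
        obtain ⟨y0, hy0, hby0⟩ := H.h4b
        obtain ⟨C', hsub, hav, hrC', hconn', hcl, b', hb'C, hbb', hb'y⟩ :=
          comp_lemma H.h3 hr'C hr'b hy0 (Or.inr hby0)
        have hlt : C'.ncard < C.ncard := by
          apply Set.ncard_lt_ncard _ (Set.toFinite _)
          exact ⟨hsub, fun h => hav y0 (h hy0) (Or.inr hby0)⟩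
        refine ih v' (τ + 1) C' b' ⟨?_, ?_, hconn', ?_, hb'y, ?_, ?_⟩ (by omega) r' hrC'
        · intro p hp1 hp2 x hx
          by_cases hp : p ≤ τ
          · rw [hvo p hp]
            exact H.h1 p hp (by omega) x (hsub hx)
          · have : p = τ + 1 := by omega
            rw [this, hvn]
            exact hav x hx
        · intro y hy x hx hyx
          by_cases hxC : x ∈ C
          · refine ⟨τ + 1, le_rfl, by omega, ?_⟩
            rw [hvn]
            exact (hcl y hy x hxC hyx).resolve_left hx
          · exact guard y (hsub hy) x hxC hyx
        · rw [hvn]; exact hbb'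
        · intro p hp1 hp2
          rw [hvo p (by omega)]
          exact fun h => H.h1 p (by omega) (by omega) b' hb'C (Or.inr h)
        · intro p q hpq hq hp
          by_cases hqτ : q ≤ τ
          · rw [hvo p (by omega), hvo q hqτ]
            exact H.h5 p q hpq hqτ (by omega)
          · have : q = τ + 1 := by omega
            rw [this, hvn, hvo p (by omega)]
            refine ⟨fun h => ?_, ?_⟩
            · exact H.h1 p (by omega) (by omega) y0 hy0 (Or.inr (h ▸ hby0))
            · by_cases hpτ : p = τ
              · rw [hpτ]
                exact ⟨fun _ => rfl, fun _ => H.h4a⟩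
              · exact ⟨fun h => (H.h4c p (by omega) (by omega) h).elim, fun h => by omega⟩

end CopHole

/-- If a finite simple connected graph `G` contains no induced cycle of length
at least `t` (`t ≥ 4`), then the cop number of `G` is at most `max 1 (t - 3)`. -/
theorem copNumber_le_of_no_long_hole [Fintype V] (G : SimpleGraph V)
    (hconn : G.Connected) (t : ℕ) (ht : 4 ≤ t)
    (hhole : ∀ n, t ≤ n → IsEmpty (cycleGraph n ↪g G)) :
    copNumber G ≤ max 1 (t - 3) := by
  classical
  rw [max_eq_right (by omega)]
  apply Nat.sInf_le
  obtain ⟨v0⟩ := hconn.nonempty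
  have hm : 1 ≤ t - 3 := by omega
  refine CopHole.exists_strategy G (t - 3) (fun _ => v0) ?_
  intro r
  by_cases hr : Step G v0 r
  · exact ⟨0 + 1, CopHole.Win.mono_one (i := ⟨0, hm⟩) hr 0⟩
  · have hU : CopHole.Conn G Set.univ := by
      intro x _ y _
      have := (SimpleGraph.reachable_iff_reflTransGen x y).1 (hconn.preconnected x y)
      exact CopHole.rtgMono (fun a b h => ⟨h, trivial, trivial⟩) this
    obtain ⟨C, -, hav, hrC, hc, hcl, b, -, hb, hby⟩ :=
      CopHole.comp_lemma hU (Set.mem_univ r) hr (Set.mem_univ v0) (Or.inl rfl)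
    have H : CopHole.Inv G (t - 3) (fun _ => v0) 0 C b := by
      refine ⟨fun _ _ _ => hav, ?_, hc, hb, hby, fun p hp => by omega,
        fun p q h1 h2 => by omega⟩
      intro y hy x hx hyx
      exact ⟨0, le_rfl, by omega, (hcl y hy x trivial hyx).resolve_left hx⟩
    exact ⟨_, H.win hm (fun n hn => hhole n (by omega)) C.ncard _ _ _ _ le_rfl r hrC⟩
end

section
/- If G is a finite connected graph with no induced cycle of length ≥ t (t ≥ 4), then t − 3 cops (at least 1) can capture the robber in at most z(G) moves, where z(G) is the minimum over vertices v of the maximum number of vertices of an induced path starting at v. -/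
open SimpleGraph

variable {V : Type*}

def WinIn (G : SimpleGraph V) (k : ℕ) : ℕ → (Fin k → V) → V → Prop
  | 0, _, _ => False
  | n + 1, c, r => ∃ c' : Fin k → V, (∀ i, Step G (c i) (c' i)) ∧
      ((∃ i, c' i = r) ∨ ∀ r', Step G r r' → WinIn G k n c' r')

theorem exists_move (G : SimpleGraph V) (k : ℕ) (c : Fin k → V) (r : V) :
    ∃ c' : Fin k → V, (∀ i, Step G (c i) (c' i)) ∧
      ∀ n, WinIn G k n c r → ((∃ i, c' i = r) ∨
        ∃ n', n' < n ∧ ∀ r', Step G r r' → WinIn G k n' c' r') := by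
  classical
  by_cases h : ∃ n, WinIn G k n c r
  · have h1 := Nat.find_spec h
    have h2 : ∀ n, WinIn G k n c r → Nat.find h ≤ n := fun n hn => Nat.find_min' h hn
    revert h1 h2
    generalize Nat.find h = N
    intro h1 h2
    cases N with
    | zero => exact h1.elim
    | succ N =>
      obtain ⟨c', hc, hw⟩ := h1
      refine ⟨c', hc, fun n hn => ?_⟩
      rcases hw with hw | hw
      · exact Or.inl hw
      · exact Or.inr ⟨N, h2 n hn, hw⟩
  · exact ⟨c, fun i => Or.inl rfl, fun n hn => (h ⟨n, hn⟩).elim⟩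

theorem strategy_of_winIn (G : SimpleGraph V) (k Z : ℕ) (c0 : Fin k → V)
    (h : ∀ r, WinIn G k Z c0 r) : ∃ S : CopStrategy G k, CapturesWithin S Z := by
  choose mv hmv hw using exists_move G k
  refine ⟨⟨c0, mv, hmv⟩, fun R => ?_⟩
  by_contra hcon
  push Not at hcon
  have key : ∀ n, n ≤ Z → ∃ n', n' + n ≤ Z ∧
      WinIn G k n' (play ⟨c0, mv, hmv⟩ R n).1 (play ⟨c0, mv, hmv⟩ R n).2 := by
    intro n
    induction n with
    | zero => intro _; exact ⟨Z, le_rfl, h _⟩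
    | succ n ih =>
      intro hn
      obtain ⟨n', h1, h2⟩ := ih (by omega)
      rcases hw _ _ n' h2 with ⟨i, hi⟩ | ⟨n'', h3, h4⟩
      · exact (hcon n hn i hi).elim
      · exact ⟨n'', by omega, h4 _ (R.move_valid _ _)⟩
  obtain ⟨n', h1, h2⟩ := key Z le_rfl
  have : n' = 0 := by omega
  subst this
  exact h2

theorem cyc_embed (G : SimpleGraph V) (N : ℕ) (hN : 2 ≤ N) (h : ℕ → V)
    (hne : ∀ i j, i < j → j ≤ N → h i ≠ h j)
    (hadj : ∀ i j, i < j → j ≤ N → (G.Adj (h i) (h j) ↔ j = i + 1 ∨ (i = 0 ∧ j = N))) :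
    Nonempty (cycleGraph (N + 1) ↪g G) := by
  have aux : ∀ i j : Fin (N + 1), i.val < j.val →
      (G.Adj (h i) (h j) ↔ (cycleGraph (N + 1)).Adj i j) := by
    intro i j hij
    rw [hadj i j hij (by omega), cycleGraph_adj', Fin.sub_def, Fin.sub_def]
    simp only
    have hi := i.isLt
    have hj := j.isLt
    rw [Nat.mod_eq_of_lt (a := N + 1 - j.val + i.val) (by omega)]
    have : N + 1 - i.val + j.val = (j.val - i.val) + (N + 1) := by omega
    rw [this, Nat.add_mod_right, Nat.mod_eq_of_lt (by omega)]
    omega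
  refine ⟨⟨⟨fun i => h i, ?_⟩, ?_⟩⟩
  · intro i j hij
    simp only at hij
    rcases lt_trichotomy i.val j.val with h1 | h1 | h1
    · exact (hne _ _ h1 (by omega) hij).elim
    · exact Fin.ext h1
    · exact (hne _ _ h1 (by omega) hij.symm).elim
  · intro i j
    change G.Adj (h i) (h j) ↔ _
    rcases lt_trichotomy i.val j.val with h1 | h1 | h1
    · exact aux i j h1
    · have := Fin.ext h1
      subst this
      simp
    · rw [G.adj_comm, (cycleGraph (N+1)).adj_comm]
      exact aux j i h1

/-- Shortest path through `C`. -/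
theorem short_path (G : SimpleGraph V) (C : Set V) (s q a b : V)
    (hs : s ∉ C) (hq : q ∉ C) (hsq : s ≠ q) (hnadj : ¬ G.Adj s q)
    (ha : a ∈ C) (hb : b ∈ C) (hsa : G.Adj s a) (hbq : G.Adj b q)
    (hconn : Relation.ReflTransGen (fun u w => G.Adj u w ∧ u ∈ C ∧ w ∈ C) a b) :
    ∃ (L : ℕ) (f : ℕ → V), 2 ≤ L ∧ f 0 = s ∧ f L = q ∧
      (∀ i, 0 < i → i < L → f i ∈ C) ∧
      (∀ i j, i < j → j ≤ L → f i ≠ f j ∧ (G.Adj (f i) (f j) ↔ j = i + 1)) := by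
  classical
  let P : ℕ → V → Prop := fun L u => ∃ f : ℕ → V, f 0 = s ∧ f L = u ∧
    (∀ i, 0 < i → i < L → f i ∈ C) ∧ (∀ i, i < L → G.Adj (f i) (f (i + 1)))
  have ext : ∀ L u w, 0 < L → P L u → u ∈ C → G.Adj u w → P (L + 1) w := by
    rintro L u w hL ⟨f, h0, hfL, hC, hA⟩ hu huw
    refine ⟨fun i => if i ≤ L then f i else w, by simp [h0], by simp, ?_, ?_⟩
    · intro i h1 h2
      simp only [show i ≤ L by omega, if_true]
      rcases Nat.lt_or_ge i L with h3 | h3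
      · exact hC i h1 h3
      · rw [show i = L by omega, hfL]; exact hu
    · intro i hi
      simp only [show i ≤ L by omega, if_true]
      rcases Nat.lt_or_ge i L with h3 | h3
      · simp only [show i + 1 ≤ L by omega, if_true]; exact hA i h3
      · have : i = L := by omega
        subst this
        simp [hfL, huw]
  have hPb : ∃ L, 0 < L ∧ P L b := by
    clear hb hbq
    induction hconn with
    | refl =>
      refine ⟨1, one_pos, fun i => if i = 0 then s else a, by simp, by simp, ?_, ?_⟩
      · intro i h1 h2; omega
      · intro i hi
        have : i = 0 := by omega
        subst this
        simpa using hsa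
    | tail _ h2 ih =>
      obtain ⟨L, hL, hP⟩ := ih
      exact ⟨L + 1, by omega, ext L _ _ hL hP h2.2.1 h2.1⟩
  have hex : ∃ L, P L q := by
    obtain ⟨L, hL, hP⟩ := hPb
    exact ⟨L + 1, ext L _ _ hL hP hb hbq⟩
  have hmin : ∀ L, P L q → Nat.find hex ≤ L := fun n hn => Nat.find_min' hex hn
  have hsp := Nat.find_spec hex
  revert hmin hsp
  generalize Nat.find hex = L
  intro hmin hsp
  obtain ⟨f, h0, hfL, hC, hA⟩ := hsp
  have hshort : ∀ i j, i < j → j ≤ L → G.Adj (f i) (f j) → j = i + 1 := by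
    intro i j hij hj hadj
    by_contra hne
    have := hmin (L - (j - i - 1)) ⟨fun x => if x ≤ i then f x else f (x + (j - i - 1)),
      by simp [h0], ?_, ?_, ?_⟩
    · omega
    · simp only [show ¬ (L - (j - i - 1) ≤ i) by omega, if_false]
      rw [show L - (j - i - 1) + (j - i - 1) = L by omega, hfL]
    · intro x h1 h2
      simp only
      split_ifs with h3
      · exact hC _ h1 (by omega)
      · exact hC _ (by omega) (by omega)
    · intro x hx
      simp only
      rcases lt_trichotomy x i with h3 | h3 | h3
      · simp only [show x ≤ i by omega, show x + 1 ≤ i by omega, if_true]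
        exact hA x (by omega)
      · subst h3
        simp only [le_refl, if_true, show ¬ (x + 1 ≤ x) by omega, if_false]
        rw [show x + 1 + (j - x - 1) = j by omega]; exact hadj
      · simp only [show ¬ (x ≤ i) by omega, show ¬ (x + 1 ≤ i) by omega, if_false]
        rw [show x + 1 + (j - i - 1) = x + (j - i - 1) + 1 by omega]
        exact hA _ (by omega)
  have hL : 2 ≤ L := by
    by_contra hlt
    have : L = 0 ∨ L = 1 := by omega
    rcases this with rfl | rfl
    · exact hsq (h0.symm.trans hfL)
    · have := hA 0 one_pos
      rw [h0, hfL] at this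
      exact hnadj this
  refine ⟨L, f, hL, h0, hfL, hC, fun i j hij hj => ⟨?_, hshort i j hij hj, ?_⟩⟩
  · intro heq
    rcases Nat.lt_or_ge j L with h3 | h3
    · have := hA j h3
      rw [← heq] at this
      have := hshort i (j + 1) (by omega) (by omega) this
      omega
    · have hjL : j = L := by omega
      rw [hjL, hfL] at heq
      rcases Nat.eq_zero_or_pos i with h4 | h4
      · rw [h4, h0] at heq; exact hsq heq
      · exact hq (heq ▸ hC i h4 (by omega))
  · rintro rfl
    exact hA i (by omega)

/-- `p 0, …, p m` is an induced path. -/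
def IndPath (G : SimpleGraph V) (p : ℕ → V) (m : ℕ) : Prop :=
  ∀ i j, i < j → j ≤ m → p i ≠ p j ∧ (G.Adj (p i) (p j) ↔ j = i + 1)

theorem hole_exists (G : SimpleGraph V) (C : Set V) (p : ℕ → V) (M j k : ℕ) (q a b : V)
    (hp : IndPath G p M) (hjk : j + k ≤ M) (hk : 1 ≤ k)
    (hCp : ∀ i, i < M → ∀ u ∈ C, p i ≠ u ∧ ¬ G.Adj (p i) u)
    (hMC : p M ∉ C) (hqC : q ∉ C) (hjq : G.Adj (p j) q)
    (hmax : ∀ i, j < i → i ≤ M → ¬ G.Adj (p i) q)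
    (hqne : ∀ i, i ≤ M → p i ≠ q)
    (ha : a ∈ C) (hb : b ∈ C) (hsa : G.Adj (p M) a) (hbq : G.Adj b q)
    (hconn : Relation.ReflTransGen (fun u w => G.Adj u w ∧ u ∈ C ∧ w ∈ C) a b) :
    ∃ n, k + 3 ≤ n ∧ Nonempty (cycleGraph n ↪g G) := by
  obtain ⟨L, f, hL, hf0, hfL, hfC, hf⟩ := short_path G C (p M) q a b hMC hqC (hqne M le_rfl)
    (hmax M (by omega) le_rfl) ha hb hsa hbq hconn
  refine ⟨M - j + L + 1, by omega, ?_⟩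
  have cross : ∀ i x, j ≤ i → i < M → 0 < x → x ≤ L →
      p i ≠ f x ∧ (G.Adj (p i) (f x) ↔ i = j ∧ x = L) := by
    intro i x h1 h2 h3 h4
    rcases Nat.lt_or_ge x L with h5 | h5
    · have := hCp i h2 _ (hfC x h3 h5)
      refine ⟨this.1, fun h => (this.2 h).elim, fun h => by omega⟩
    · have : x = L := by omega
      subst this
      rw [hfL]
      refine ⟨hqne i h2.le, fun h => ⟨?_, rfl⟩, fun h => h.1 ▸ hjq⟩
      by_contra hne
      exact hmax i (by omega) h2.le h
  have key : ∀ x y, x < y → y ≤ M - j + L →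
      (fun i => if i ≤ M - j then p (j + i) else f (i - (M - j))) x ≠
      (fun i => if i ≤ M - j then p (j + i) else f (i - (M - j))) y ∧
      (G.Adj ((fun i => if i ≤ M - j then p (j + i) else f (i - (M - j))) x)
      ((fun i => if i ≤ M - j then p (j + i) else f (i - (M - j))) y) ↔
        y = x + 1 ∨ (x = 0 ∧ y = M - j + L)) := by
    intro x y hxy hy
    simp only
    by_cases h2 : y ≤ M - j
    · simp only [h2, show x ≤ M - j by omega, if_true]
      have := hp (j + x) (j + y) (by omega) (by omega)
      refine ⟨this.1, this.2.trans ?_⟩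
      omega
    · by_cases h1 : x < M - j
      · simp only [h2, show x ≤ M - j by omega, if_true, if_false]
        have := cross (j + x) (y - (M - j)) (by omega) (by omega) (by omega) (by omega)
        refine ⟨this.1, this.2.trans ?_⟩
        omega
      · have hx : (if x ≤ M - j then p (j + x) else f (x - (M - j))) = f (x - (M - j)) := by
          split_ifs with h3
          · rw [show j + x = M by omega, show x - (M - j) = 0 by omega, hf0]
          · rfl
        rw [hx]
        simp only [h2, if_false]
        have := hf (x - (M - j)) (y - (M - j)) (by omega) (by omega)
        refine ⟨this.1, this.2.trans ?_⟩
        omega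
  exact cyc_embed G (M - j + L) (by omega) _ (fun x y h1 h2 => (key x y h1 h2).1)
    (fun x y h1 h2 => (key x y h1 h2).2)

theorem indPath_le_zval [Fintype V] (G : SimpleGraph V) (p : ℕ → V) (m : ℕ)
    (hp : IndPath G p m) : m + 1 ≤ zval G (p 0) := by
  apply le_csSup
  · refine ⟨Fintype.card V, ?_⟩
    rintro n ⟨f, -, -⟩
    simpa using Fintype.card_le_of_injective f f.injective
  · refine ⟨⟨⟨fun i => p i, ?_⟩, ?_⟩, Nat.succ_pos m, rfl⟩
    · intro i j hij
      simp only at hij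
      rcases lt_trichotomy i.val j.val with h1 | h1 | h1
      · exact ((hp _ _ h1 (by omega)).1 hij).elim
      · exact Fin.ext h1
      · exact ((hp _ _ h1 (by omega)).1 hij.symm).elim
    · intro i j
      rw [pathGraph_adj]
      change G.Adj (p i) (p j) ↔ _
      rcases lt_trichotomy i.val j.val with h1 | h1 | h1
      · rw [(hp _ _ h1 (by omega)).2]; omega
      · rw [h1]; simp
      · rw [G.adj_comm, (hp _ _ h1 (by omega)).2]; omega

def SetConn (G : SimpleGraph V) (C : Set V) : Prop :=
  ∀ a ∈ C, ∀ b ∈ C, Relation.ReflTransGen (fun u w => G.Adj u w ∧ u ∈ C ∧ w ∈ C) a b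

theorem exit_lemma (G : SimpleGraph V) (S : Set V) (hS : SetConn G S) (y r x : V)
    (hr : r ∈ S) (hry : ¬ Step G y r) (hx : x ∈ S) (hxy : Step G y x) :
    ∃ C : Set V, C ⊆ S ∧ r ∈ C ∧ SetConn G C ∧ (∀ u ∈ C, ¬ Step G y u) ∧
      (∀ u ∈ C, ∀ w, G.Adj u w → w ∈ C ∨ w ∉ S ∨ Step G y w) ∧
      ∃ y' ∈ S, G.Adj y y' ∧ ∃ u ∈ C, G.Adj y' u := by
  let T : Set V := {u | u ∈ S ∧ ¬ Step G y u}
  let Rel : V → V → Prop := fun u w => G.Adj u w ∧ u ∈ T ∧ w ∈ T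
  let C : Set V := {u | Relation.ReflTransGen Rel r u}
  have hrT : r ∈ T := ⟨hr, hry⟩
  have hCT : ∀ u ∈ C, u ∈ T := by
    intro u hu
    rcases Relation.ReflTransGen.cases_tail hu with h | ⟨_, _, h⟩
    · rw [h]; exact hrT
    · exact h.2.2
  have hrC : r ∈ C := Relation.ReflTransGen.refl
  have hfrom : ∀ u ∈ C,
      Relation.ReflTransGen (fun u w => G.Adj u w ∧ u ∈ C ∧ w ∈ C) r u := by
    intro u hu
    change Relation.ReflTransGen Rel r u at hu
    induction hu with
    | refl => exact Relation.ReflTransGen.refl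
    | tail h1 h2 ih => exact ih.tail ⟨h2.1, h1, h1.tail h2⟩
  have hsymm : Std.Symm (fun u w => G.Adj u w ∧ u ∈ C ∧ w ∈ C) :=
    ⟨fun u w h => ⟨h.1.symm, h.2.2, h.2.1⟩⟩
  have hcl : ∀ u ∈ C, ∀ w, G.Adj u w → w ∈ C ∨ w ∉ S ∨ Step G y w := by
    intro u hu w huw
    by_cases hw : w ∈ T
    · exact Or.inl (Relation.ReflTransGen.tail hu ⟨huw, hCT u hu, hw⟩)
    · right
      by_contra hcon
      push Not at hcon
      exact hw hcon
  refine ⟨C, fun u hu => (hCT u hu).1, hrC, ?_, fun u hu => (hCT u hu).2, hcl, ?_⟩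
  · intro a ha b hb
    exact (Relation.ReflTransGen.stdSymm.symm _ _ (hfrom a ha)).trans (hfrom b hb)
  · by_contra hcon
    have : ∀ u, Relation.ReflTransGen (fun u w => G.Adj u w ∧ u ∈ S ∧ w ∈ S) r u → u ∈ C := by
      intro u hu
      induction hu with
      | refl => exact hrC
      | @tail b c h1 h2 ih =>
        rcases hcl _ ih _ h2.1 with h | h | h
        · exact h
        · exact (h h2.2.2).elim
        · rcases h with h | h
          · exact ((hCT _ ih).2 (Or.inr (h ▸ h2.1.symm))).elim
          · exact (hcon ⟨c, h2.2.2, h, _, ih, h2.1.symm⟩).elim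
    exact (hCT x (this x (hS r hr x hx))).2 hxy

structure GameInv (G : SimpleGraph V) (k m : ℕ) (p : ℕ → V) (C : Set V) (y : V)
    (c : Fin k → V) (r : V) : Prop where
  path : IndPath G p m
  cops : ∀ i, c i = p (m - i)
  rC : r ∈ C
  conn : SetConn G C
  avoid : ∀ i, i ≤ m → ∀ u ∈ C, p i ≠ u ∧ ¬ G.Adj (p i) u
  closed : ∀ u ∈ C, ∀ w, G.Adj u w → w ∈ C ∨ ∃ i, i ≤ m ∧ G.Adj (p i) w
  adjy : G.Adj (p m) y
  nadjy : ∀ i, i < m → ¬ G.Adj (p i) y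
  yC : ∃ x ∈ C, G.Adj y x

theorem main_win [Fintype V] (G : SimpleGraph V) (k : ℕ) (hk : 1 ≤ k)
    (hhole : ∀ n, k + 3 ≤ n → IsEmpty (cycleGraph n ↪g G)) (v : V) (n : ℕ) :
    ∀ m p C y c r, p 0 = v → zval G v ≤ m + n → GameInv G k m p C y c r → WinIn G k n c r := by
  classical
  induction n with
  | zero =>
    intro m p C y c r hv hz I
    have := indPath_le_zval G p m I.path
    rw [hv] at this
    omega
  | succ n ih =>
    intro m p C y c r hv hz I
    obtain ⟨x, hxC, hyx⟩ := I.yC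
    have hyp : ∀ i, i ≤ m → p i ≠ y := by
      rintro i hi rfl
      exact (I.avoid i hi x hxC).2 hyx
    have hyC : y ∉ C := fun h => (I.avoid m le_rfl y h).2 I.adjy
    obtain ⟨p', hp'1, hp'2⟩ : ∃ p' : ℕ → V, (∀ i, i ≤ m → p' i = p i) ∧ p' (m + 1) = y :=
      ⟨fun i => if i ≤ m then p i else y, fun i hi => by simp [hi], by simp⟩
    have hP' : IndPath G p' (m + 1) := by
      intro i j hij hj
      rcases Nat.lt_or_ge m j with h | h
      · have : j = m + 1 := by omega
        subst this
        rw [hp'2, hp'1 i (by omega)]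
        refine ⟨hyp i (by omega), ?_, ?_⟩
        · intro h
          by_contra hne
          exact I.nadjy i (by omega) h
        · intro h
          have : i = m := by omega
          subst this
          exact I.adjy
      · rw [hp'1 i (by omega), hp'1 j h]
        exact I.path i j hij h
    have hzz := indPath_le_zval G p' (m + 1) hP'
    rw [hp'1 0 (by omega), hv] at hzz
    refine ⟨fun i => p' (m + 1 - i), ?_, Or.inr ?_⟩
    · intro i
      rw [I.cops i]
      rcases Nat.lt_or_ge m i.val with h | h
      · left
        simp only
        rw [show m - i.val = 0 by omega, show m + 1 - i.val = 0 by omega, hp'1 0 (by omega)]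
      · right
        rw [← hp'1 (m - i) (by omega)]
        exact (hP' _ _ (by omega) (by omega)).2.2 (by omega)
    intro r' hr'
    by_cases hcap : ∃ i : Fin k, Step G (p' (m + 1 - i)) r'
    · obtain ⟨i, hi⟩ := hcap
      obtain ⟨n, rfl⟩ : ∃ n', n = n' + 1 := ⟨n - 1, by omega⟩
      refine ⟨Function.update (fun i : Fin k => p' (m + 1 - i)) i r', ?_, Or.inl ⟨i, by simp⟩⟩
      intro i'
      by_cases h : i' = i
      · subst h; simpa using hi
      · simp only [Function.update_of_ne h]; exact Or.inl rfl
    push Not at hcap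
    have hy0 : ¬ Step G y r' := by
      have := hcap ⟨0, hk⟩
      simpa [hp'2] using this
    have hr'C : r' ∈ C := by
      by_contra hnC
      have hrr' : G.Adj r r' := by
        rcases hr' with h | h
        · exact (hnC (h ▸ I.rC)).elim
        · exact h
      rcases I.closed r I.rC r' hrr' with h | ⟨i, him, hi⟩
      · exact hnC h
      have hQ : G.Adj (p' i) r' := by rw [hp'1 i him]; exact hi
      set j := Nat.findGreatest (fun i => G.Adj (p' i) r') (m + 1) with hj
      have hjle : j ≤ m + 1 := Nat.findGreatest_le _
      have hjadj : G.Adj (p' j) r' :=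
        Nat.findGreatest_spec (P := fun i => G.Adj (p' i) r') (m := i) (n := m + 1) (by omega) hQ
      have hjmax : ∀ i, j < i → i ≤ m + 1 → ¬ G.Adj (p' i) r' := fun i h1 h2 =>
        Nat.findGreatest_is_greatest (P := fun i => G.Adj (p' i) r') h1 h2
      have hjk : j + k ≤ m + 1 := by
        by_contra hlt
        apply hcap ⟨m + 1 - j, by omega⟩
        right
        simp only
        rw [show m + 1 - (m + 1 - j) = j by omega]
        exact hjadj
      obtain ⟨N, hN, ⟨e⟩⟩ := hole_exists G C p' (m + 1) j k r' x r hP' hjk hk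
        (fun i hi u hu => by rw [hp'1 i (by omega)]; exact I.avoid i (by omega) u hu)
        (by rw [hp'2]; exact hyC) hnC hjadj hjmax
        (by
          intro i hi heq
          rcases Nat.lt_or_ge m i with h | h
          · have : i = m + 1 := by omega
            subst this
            rw [hp'2] at heq
            exact hy0 (Or.inl heq)
          · rw [hp'1 i h] at heq
            apply (I.avoid i h r I.rC).2
            rw [heq]; exact hrr'.symm)
        hxC I.rC (by rw [hp'2]; exact hyx) hrr' (I.conn x hxC r I.rC)
      exact (hhole N hN).false e
    obtain ⟨C', hC'C, hrC', hconn', hav', hcl', y', hy'C, hyy', hu⟩ :=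
      exit_lemma G C I.conn y r' x hr'C hy0 hxC (Or.inr hyx)
    refine ih (m + 1) p' C' y' _ r' (by rw [hp'1 0 (by omega), hv]) (by omega) ?_
    refine ⟨hP', fun i => rfl, hrC', hconn', ?_, ?_, by rw [hp'2]; exact hyy', ?_, hu⟩
    · intro i hi u hu
      rcases Nat.lt_or_ge m i with h | h
      · have : i = m + 1 := by omega
        subst this
        rw [hp'2]
        exact ⟨fun h => hav' u hu (Or.inl h), fun h => hav' u hu (Or.inr h)⟩
      · rw [hp'1 i h]; exact I.avoid i h u (hC'C hu)
    · intro u hu w huw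
      have hC : w ∉ C → ∃ i, i ≤ m + 1 ∧ G.Adj (p' i) w := by
        intro hw
        rcases I.closed u (hC'C hu) w huw with h | ⟨i, hi, h⟩
        · exact (hw h).elim
        · exact ⟨i, by omega, by rw [hp'1 i hi]; exact h⟩
      rcases hcl' u hu w huw with h | h | h | h
      · exact Or.inl h
      · exact Or.inr (hC h)
      · exact (hav' u hu (Or.inr (h ▸ huw.symm))).elim
      · exact Or.inr ⟨m + 1, le_rfl, by rw [hp'2]; exact h⟩
    · intro i hi
      rw [hp'1 i (by omega)]
      exact (I.avoid i (by omega) y' hy'C).2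

theorem initial_win [Fintype V] (G : SimpleGraph V) (hconn : G.Connected) (k : ℕ) (hk : 1 ≤ k)
    (hhole : ∀ n, k + 3 ≤ n → IsEmpty (cycleGraph n ↪g G)) (v r : V) :
    WinIn G k (zval G v) (fun _ => v) r := by
  have hz : 1 ≤ zval G v :=
    indPath_le_zval G (fun _ => v) 0 (fun i j h1 h2 => by omega)
  by_cases hs : Step G v r
  · obtain ⟨n, hn⟩ : ∃ n', zval G v = n' + 1 := ⟨zval G v - 1, by omega⟩
    rw [hn]
    exact ⟨fun _ => r, fun _ => hs, Or.inl ⟨⟨0, hk⟩, rfl⟩⟩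
  have hU : SetConn G Set.univ := by
    intro a _ b _
    have := (G.reachable_iff_reflTransGen a b).1 (hconn.preconnected a b)
    induction this with
    | refl => exact Relation.ReflTransGen.refl
    | tail _ h2 ih => exact (ih trivial).tail ⟨h2, trivial, trivial⟩
  obtain ⟨C, -, hrC, hcc, hav, hcl, y, -, hvy, hu⟩ :=
    exit_lemma G Set.univ hU v r v trivial hs trivial (Or.inl rfl)
  refine main_win G k hk hhole v _ 0 (fun _ => v) C y _ r rfl (by omega) ?_
  refine ⟨fun i j h1 h2 => by omega, fun _ => rfl, hrC, hcc, ?_, ?_, hvy,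
    fun i hi => by omega, hu⟩
  · intro i hi u hu
    exact ⟨fun h => hav u hu (Or.inl h), fun h => hav u hu (Or.inr h)⟩
  · intro u hu w huw
    rcases hcl u hu w huw with h | h | h | h
    · exact Or.inl h
    · exact (h trivial).elim
    · exact (hav u hu (Or.inr (h ▸ huw.symm))).elim
    · exact Or.inr ⟨0, le_rfl, h⟩

/-- If `G` is a finite connected graph with no induced cycle of length ≥ t
(`t ≥ 4`), then `max 1 (t - 3)` cops can capture the robber in at most `z(G)` moves. -/
theorem cops_capture_within_zNum [Fintype V] (G : SimpleGraph V)
    (hconn : G.Connected) (t : ℕ) (ht : 4 ≤ t)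
    (hhole : ∀ n, t ≤ n → IsEmpty (cycleGraph n ↪g G)) :
    ∃ S : CopStrategy G (max 1 (t - 3)), CapturesWithin S (zNum G) := by
  obtain ⟨v, hv⟩ : zNum G ∈ {n | ∃ v : V, zval G v = n} := by
    obtain ⟨v⟩ := hconn.nonempty
    exact Nat.sInf_mem ⟨_, v, rfl⟩
  rw [← hv]
  exact strategy_of_winIn G _ _ (fun _ => v) fun r =>
    initial_win G hconn _ (by omega) (fun n hn => hhole n (by omega)) v r
end
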